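/- arXiv:0712.2448 — 3 statements merged into one kernel-verified Lean document; each statement's English description precedes it below -/
import Mathlib

section
/- The function N_{g,L} defined by the explicit formula satisfies the recursion: for every integer g ≥ 0, every integer L ≥ 1 and all positive integers n_1, …, n_L, one has (L + 2g − 1) · N_{g,L}(n_1, …, n_L) = Σ_{1 ≤ i < j ≤ L} n_i n_j · N_{g,L−1}(n_i + n_j + 2, n_1, …, ň_i, …, ň_j, …, n_L) + (1/2) Σ_{i=1}^{L} n_i · Σ_{x=1}^{n_i+1} N_{g−1,L+1}(n_i + 2 − x, x, n_1, …, ň_i, …, n_L), where ň denotes omission of an argument. -/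
open Finset

/-- The explicit formula `N_{g,L}(n_1, …, n_L)` (genus `g : ℤ`, boundary lengths given by
the list `ns` of length `L`), with the convention that the value is `0` when `g < 0` or
`L = 0`. -/
noncomputable def Ncal (g : ℤ) (ns : List ℕ) : ℚ :=
  if g < 0 ∨ ns = [] then 0
  else
    (1 / 4 ^ g.toNat) * (ns.map (fun n => (n : ℚ))).prod *
      ((Nat.factorial (ns.sum + 4 * g.toNat + 2 * ns.length - 3) : ℚ) /
        (Nat.factorial (ns.sum + 2 * g.toNat + ns.length - 1) : ℚ)) *
      ∑ lam ∈ Finset.Nat.antidiagonalTuple ns.length g.toNat,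
        ∏ k : Fin ns.length,
          (Nat.factorial (2 * lam k + ns.get k) : ℚ) /
            ((Nat.factorial (ns.get k) : ℚ) * (Nat.factorial (2 * lam k + 1) : ℚ))

namespace OddGeom

open PowerSeries

/-- The geometric series `1 / (1 - X)`. -/
noncomputable def geom : ℚ⟦X⟧ := mk 1

/-- The alternating geometric series `1 / (1 + X)`. -/
noncomputable def altGeom : ℚ⟦X⟧ := rescale (-1) geom

/-- The odd part of `(1 - X)⁻ⁿ`. -/
noncomputable def oddPart (n : ℕ) : ℚ⟦X⟧ := C (1 / 2) * (geom ^ n - altGeom ^ n)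

/-- The even part of `(1 - X)⁻ⁿ`. -/
noncomputable def evenPart (n : ℕ) : ℚ⟦X⟧ := C (1 / 2) * (geom ^ n + altGeom ^ n)

lemma two_mul_C_half : (2 : ℚ⟦X⟧) * C (1 / 2) = 1 := by
  rw [← map_ofNat (C (R := ℚ)) 2, ← map_mul]
  norm_num

lemma geom_eq : geom = 1 + X * geom := by
  have h := mk_one_mul_one_sub_eq_one ℚ
  unfold geom
  linear_combination h

lemma altGeom_eq : altGeom = 1 - X * altGeom := by
  have h := congrArg (rescale (-1 : ℚ)) geom_eq
  rw [map_add, map_mul, map_one, rescale_X] at h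
  simpa [altGeom, sub_eq_add_neg] using h

lemma derivative_geom : d⁄dX ℚ geom = geom ^ 2 := by
  have h : geom * (1 - X) = 1 := mk_one_mul_one_sub_eq_one ℚ
  rw [Derivation.leibniz_of_mul_eq_one _ h]
  simp

lemma derivative_altGeom : d⁄dX ℚ altGeom = -altGeom ^ 2 := by
  have h : altGeom * (1 + X) = 1 := by linear_combination altGeom_eq
  rw [Derivation.leibniz_of_mul_eq_one _ h]
  simp

lemma derivative_oddPart (n : ℕ) : d⁄dX ℚ (oddPart n) = n * evenPart (n + 1) := by
  cases n with
  | zero => simp [oddPart]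
  | succ n =>
    simp only [oddPart, evenPart, Derivation.leibniz, map_sub, Derivation.leibniz_pow,
      derivative_geom, derivative_altGeom, derivative_C, smul_eq_mul, nsmul_eq_mul,
      Nat.add_sub_cancel]
    ring

lemma oddPart_succ (n : ℕ) : oddPart (n + 1) = oddPart n + X * evenPart (n + 1) := by
  unfold oddPart evenPart
  linear_combination C (1 / 2) * geom ^ n * geom_eq - C (1 / 2) * altGeom ^ n * altGeom_eq

lemma oddPart_add (m n : ℕ) :
    oddPart (m + n) = oddPart m * evenPart n + oddPart n * evenPart m := by
  unfold oddPart evenPart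
  linear_combination (-C (1 / 2) * (geom ^ (m + n) - altGeom ^ (m + n))) * two_mul_C_half

lemma X_mul_sum_oddPart (n : ℕ) :
    2 * X * ∑ x ∈ Icc 1 (n + 1), oddPart (n + 2 - x) * oddPart x =
      ((n : ℚ⟦X⟧) + 1) * X * evenPart (n + 2) - oddPart (n + 1) := by
  have hsum : ∑ x ∈ Icc 1 (n + 1), oddPart (n + 2 - x) * oddPart x =
      C (1 / 2) ^ 2 * (((n : ℚ⟦X⟧) + 1) * (geom ^ (n + 2) + altGeom ^ (n + 2)) -
        2 * (geom * altGeom) * ∑ i ∈ range (n + 1), geom ^ i * altGeom ^ (n - i)) := by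
    have hterm : ∀ i ∈ range (n + 1), oddPart (n + 2 - (1 + i)) * oddPart (1 + i) =
        C (1 / 2) ^ 2 * (geom ^ (n + 2) + altGeom ^ (n + 2)
          - (geom * altGeom) * (geom ^ i * altGeom ^ (n - i))
          - (geom * altGeom) * (geom ^ (n - i) * altGeom ^ (n - (n - i)))) := by
      intro i hi
      obtain ⟨k, rfl⟩ : ∃ k, n = i + k := Nat.exists_eq_add_of_le (by grind)
      rw [show i + k + 2 - (1 + i) = k + 1 by omega, show i + k - i = k by omega,
        show i + k - k = i by omega]
      unfold oddPart
      ring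
    rw [← Finset.Ico_add_one_right_eq_Icc, Finset.sum_Ico_eq_sum_range]
    simp only [Nat.add_sub_cancel]
    rw [Finset.sum_congr rfl hterm, ← Finset.mul_sum, Finset.sum_sub_distrib,
      Finset.sum_sub_distrib, ← Finset.mul_sum, ← Finset.mul_sum]
    have hrefl := Finset.sum_range_reflect (fun i => geom ^ i * altGeom ^ (n - i)) (n + 1)
    simp only [Nat.add_sub_cancel] at hrefl
    rw [hrefl]
    simp only [sum_const, card_range, nsmul_eq_mul]
    push_cast
    ring
  have hgeom := (Commute.all geom altGeom).geom_sum₂_mul (n + 1)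
  simp only [Nat.add_sub_cancel] at hgeom
  have hsub : geom - altGeom = 2 * X * (geom * altGeom) := by
    linear_combination altGeom * geom_eq - geom * altGeom_eq
  rw [hsum]
  unfold oddPart evenPart
  linear_combination C (1 / 2) * (((n : ℚ⟦X⟧) + 1) * X * (geom ^ (n + 2) + altGeom ^ (n + 2)) -
      (geom ^ (n + 1) - altGeom ^ (n + 1))) * two_mul_C_half - 2 * C (1 / 2) ^ 2 * hgeom +
    2 * C (1 / 2) ^ 2 * (∑ i ∈ range (n + 1), geom ^ i * altGeom ^ (n - i)) * hsub

lemma derivative_finset_prod {ι : Type*} [DecidableEq ι] (s : Finset ι) (f : ι → ℚ⟦X⟧) :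
    d⁄dX ℚ (∏ i ∈ s, f i) = ∑ i ∈ s, d⁄dX ℚ (f i) * ∏ k ∈ s.erase i, f k := by
  induction s using Finset.induction_on with
  | empty => simp
  | insert a s ha ih =>
    rw [prod_insert ha, Derivation.leibniz, ih, sum_insert ha, erase_insert ha, smul_eq_mul,
      smul_eq_mul, mul_sum, add_comm, mul_comm]
    congr 1
    refine sum_congr rfl fun i hi => ?_
    have hne : a ≠ i := fun h => ha (h ▸ hi)
    rw [erase_insert_of_ne hne, prod_insert fun h => ha (mem_of_mem_erase h)]
    ring

section Product

variable {L : ℕ} (n : Fin L → ℕ)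

lemma sum_mul_oddPart_succ :
    ∑ i, (n i : ℚ⟦X⟧) * (oddPart (n i + 1) * ∏ k ∈ univ.erase i, oddPart (n k)) =
      ((∑ i, n i : ℕ) : ℚ⟦X⟧) * ∏ i, oddPart (n i) + X * d⁄dX ℚ (∏ i, oddPart (n i)) := by
  rw [derivative_finset_prod, mul_sum, Nat.cast_sum, sum_mul, ← sum_add_distrib]
  refine sum_congr rfl fun i hi => ?_
  rw [← mul_prod_erase univ (fun k => oddPart (n k)) hi, oddPart_succ, derivative_oddPart]
  ring

lemma sum_pairs_oddPart :
    ∑ i, ∑ j ∈ Ioi i, (n i : ℚ⟦X⟧) * n j *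
        (oddPart (n i + n j + 2) * ∏ k ∈ (univ.erase i).erase j, oddPart (n k)) =
      ∑ i, (n i : ℚ⟦X⟧) * (oddPart (n i + 1) *
        d⁄dX ℚ (∏ k ∈ univ.erase i, oddPart (n k))) := by
  have hpair : ∀ i j, (n i : ℚ⟦X⟧) * n j *
        (oddPart (n i + n j + 2) * ∏ k ∈ (univ.erase i).erase j, oddPart (n k)) =
      (n i : ℚ⟦X⟧) * (oddPart (n i + 1) *
        (n j * evenPart (n j + 1) * ∏ k ∈ (univ.erase i).erase j, oddPart (n k))) +
      (n j : ℚ⟦X⟧) * (oddPart (n j + 1) *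
        (n i * evenPart (n i + 1) * ∏ k ∈ (univ.erase j).erase i, oddPart (n k))) := by
    intro i j
    rw [show n i + n j + 2 = (n i + 1) + (n j + 1) by ring, oddPart_add,
      erase_right_comm (s := univ) (a := j)]
    ring
  simp_rw [hpair]
  rw [sum_sum_Ioi_add_eq_sum_sum_off_diag (fun j i => (n i : ℚ⟦X⟧) * (oddPart (n i + 1) *
        (n j * evenPart (n j + 1) * ∏ k ∈ (univ.erase i).erase j, oddPart (n k))))]
  refine sum_congr rfl fun i _ => ?_
  rw [derivative_finset_prod, mul_sum, mul_sum, compl_singleton]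
  simp_rw [derivative_oddPart]

/-- The join terms and cut terms combine into a differential operator acting on the product of
the series `oddPart (n i)`. -/
lemma X_mul_join_add_cut :
    X * (∑ i, ∑ j ∈ Ioi i, (n i : ℚ⟦X⟧) * n j *
          (oddPart (n i + n j + 2) * ∏ k ∈ (univ.erase i).erase j, oddPart (n k)) +
        2 * ∑ i, (n i : ℚ⟦X⟧) * ∑ x ∈ Icc 1 (n i + 1),
          oddPart (n i + 2 - x) * oddPart x * ∏ k ∈ univ.erase i, oddPart (n k)) =
      X * d⁄dX ℚ (((∑ i, n i : ℕ) : ℚ⟦X⟧) * ∏ i, oddPart (n i) + X * d⁄dX ℚ (∏ i, oddPart (n i))) -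
        (((∑ i, n i : ℕ) : ℚ⟦X⟧) * ∏ i, oddPart (n i) + X * d⁄dX ℚ (∏ i, oddPart (n i))) := by
  rw [← sum_mul_oddPart_succ, sum_pairs_oddPart, map_sum, mul_sum, mul_add, mul_sum, mul_sum,
    mul_sum, ← sum_add_distrib, ← sum_sub_distrib]
  refine sum_congr rfl fun i _ => ?_
  have hD : d⁄dX ℚ (n i : ℚ⟦X⟧) = 0 := Derivation.map_natCast _ _
  simp only [Derivation.leibniz, hD, derivative_oddPart, smul_eq_mul, ← sum_mul]
  push_cast
  linear_combination (n i : ℚ⟦X⟧) * (∏ k ∈ univ.erase i, oddPart (n k)) * X_mul_sum_oddPart (n i)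

lemma coeff_join_add_cut (m : ℕ) :
    (∑ i, ∑ j ∈ Ioi i, (n i : ℚ) * n j *
        coeff m (oddPart (n i + n j + 2) * ∏ k ∈ (univ.erase i).erase j, oddPart (n k))) +
      2 * ∑ i, (n i : ℚ) * ∑ x ∈ Icc 1 (n i + 1),
        coeff m (oddPart (n i + 2 - x) * oddPart x * ∏ k ∈ univ.erase i, oddPart (n k)) =
      m * (((∑ i, n i : ℕ) : ℚ) + m + 1) * coeff (m + 1) (∏ i, oddPart (n i)) := by
  have hcast : ∀ (a : ℕ) (f : ℚ⟦X⟧) (d : ℕ), coeff d ((a : ℚ⟦X⟧) * f) = a * coeff d f := by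
    intro a f d
    rw [← map_natCast (C (R := ℚ)) a, coeff_C_mul]
  have h := congrArg (coeff (R := ℚ) (m + 1)) (X_mul_join_add_cut n)
  rw [coeff_succ_X_mul, map_sub, coeff_succ_X_mul, coeff_derivative, map_add,
    show (2 : ℚ⟦X⟧) = ((2 : ℕ) : ℚ⟦X⟧) by norm_num, hcast, map_sum, map_sum, map_add, hcast,
    coeff_succ_X_mul, coeff_derivative] at h
  simp only [map_sum, mul_assoc, hcast] at h
  simp only [mul_assoc]
  push_cast at h ⊢
  linear_combination h

end Product

/-- The power series `Q` with `oddPart n = X * Q (X ^ 2)`. -/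
noncomputable def oddCoeffs (n : ℕ) : ℚ⟦X⟧ :=
  mk fun l => (n : ℚ) * ((2 * l + n).factorial / (n.factorial * (2 * l + 1).factorial))

lemma oddPart_eq_X_mul_expand {n : ℕ} (hn : 0 < n) :
    oddPart n = X * expand 2 two_ne_zero (oddCoeffs n) := by
  obtain ⟨d, rfl⟩ : ∃ d, n = d + 1 := ⟨n - 1, by omega⟩
  ext m
  have hodd : coeff m (oddPart (d + 1)) = 1 / 2 * (1 - (-1) ^ m) * ((d + m).choose d : ℚ) := by
    rw [oddPart, altGeom, ← map_pow, coeff_C_mul, map_sub, coeff_rescale, geom,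
      mk_one_pow_eq_mk_choose_add, coeff_mk]
    ring
  rw [hodd]
  cases m with
  | zero => simp
  | succ m =>
    rw [coeff_succ_X_mul, coeff_expand]
    split_ifs with h
    · obtain ⟨l, rfl⟩ := h
      have hneg : (-1 : ℚ) ^ (2 * l + 1) = -1 := by rw [pow_succ, pow_mul]; norm_num
      rw [hneg, oddCoeffs, coeff_mk, Nat.mul_div_cancel_left _ two_pos, Nat.choose_symm_add,
        Nat.add_choose, Nat.cast_div (Nat.factorial_mul_factorial_dvd_factorial_add _ _) (by positivity),
        show 2 * l + (d + 1) = d + (2 * l + 1) by ring, Nat.factorial_succ d]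
      push_cast
      field_simp
      norm_num
    · have hneg : (-1 : ℚ) ^ (m + 1) = 1 := Even.neg_one_pow (by grind)
      simp [hneg]

lemma prod_map_oddPart {ns : List ℕ} (hpos : ∀ n ∈ ns, 0 < n) :
    (ns.map oddPart).prod =
      X ^ ns.length * expand 2 two_ne_zero (ns.map oddCoeffs).prod := by
  induction ns with
  | nil => simp
  | cons a l ih =>
    rw [List.map_cons, List.prod_cons, ih fun n hn => hpos n (by simp [hn]),
      oddPart_eq_X_mul_expand (hpos a (by simp)), List.map_cons, List.prod_cons, map_mul,
      List.length_cons]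
    ring

lemma coeff_prod_map_oddPart {ns : List ℕ} (hpos : ∀ n ∈ ns, 0 < n) (g : ℕ) :
    coeff (2 * g + ns.length) (ns.map oddPart).prod =
      (ns.map (fun n : ℕ => (n : ℚ))).prod *
        ∑ lam ∈ Finset.Nat.antidiagonalTuple ns.length g,
          ∏ k : Fin ns.length, ((2 * lam k + ns.get k).factorial : ℚ) /
            (((ns.get k).factorial : ℚ) * ((2 * lam k + 1).factorial : ℚ)) := by
  have hprod : ∀ {M : Type} [CommMonoid M] (f : ℕ → M),
      (ns.map f).prod = ∏ k : Fin ns.length, f (ns.get k) := fun f => by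
    rw [← List.prod_ofFn, List.ofFn_comp', List.ofFn_get]
  rw [prod_map_oddPart hpos, coeff_X_pow_mul, coeff_expand_mul, hprod, coeff_prod, hprod, mul_sum]
  refine sum_bij' (fun l _ => ⇑l) (fun l _ => Finsupp.equivFunOnFinite.symm l) ?_ ?_ ?_ ?_ ?_
  · simp [Finset.Nat.mem_antidiagonalTuple]
  · simp [Finset.Nat.mem_antidiagonalTuple]
  · intros; ext; simp
  · intros; ext; simp
  · intro l _
    simp only [oddCoeffs, coeff_mk, prod_mul_distrib]

lemma coeff_prod_map_oddPart_of_lt {ns : List ℕ} (hpos : ∀ n ∈ ns, 0 < n) {m : ℕ}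
    (hm : m < ns.length) : coeff m (ns.map oddPart).prod = 0 := by
  rw [prod_map_oddPart hpos, coeff_X_pow_mul', if_neg (by omega)]

theorem Ncal_eq_coeff (g : ℕ) {ns : List ℕ} (hns : ns ≠ []) (hpos : ∀ n ∈ ns, 0 < n) :
    Ncal g ns = 1 / 4 ^ g * (((ns.sum + 4 * g + 2 * ns.length - 3).factorial : ℚ) /
        ((ns.sum + 2 * g + ns.length - 1).factorial : ℚ)) *
      coeff (2 * g + ns.length) (ns.map oddPart).prod := by
  rw [coeff_prod_map_oddPart hpos, Ncal, if_neg (by simp [hns])]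
  have hmap : (do let a ← ns; pure (a : ℚ) : List ℚ) = ns.map (fun n : ℕ => (n : ℚ)) := by
    simp [List.map_eq_flatMap]
  rw [hmap]
  simp only [Int.toNat_natCast, List.map_id']
  ring

lemma coe_eraseIdx (ns : List ℕ) (i : Fin ns.length) :
    (ns.eraseIdx i : Multiset ℕ) = (univ.erase i).val.map ns.get := by
  have h := Multiset.coe_eq_coe.mpr (List.getElem_cons_eraseIdx_perm i.isLt)
  have h' : (ns : Multiset ℕ) = univ.val.map ns.get := by
    simp [Fin.univ_val_map]
  rw [h', ← insert_erase (mem_univ i), insert_val_of_notMem (notMem_erase i univ),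
    Multiset.map_cons, ← Multiset.cons_coe] at h
  exact (Multiset.cons_inj_right _).mp h

lemma coe_eraseIdx_eraseIdx (ns : List ℕ) {i j : Fin ns.length} (hij : i < j) :
    (((ns.eraseIdx j).eraseIdx i : List ℕ) : Multiset ℕ) =
      ((univ.erase i).erase j).val.map ns.get := by
  have hi : (i : ℕ) < (ns.eraseIdx j).length := by
    rw [List.length_eraseIdx_of_lt j.isLt]
    omega
  have h := Multiset.coe_eq_coe.mpr (List.getElem_cons_eraseIdx_perm hi)
  rw [coe_eraseIdx, ← insert_erase (mem_erase.mpr ⟨hij.ne, mem_univ i⟩),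
    insert_val_of_notMem (notMem_erase i _), Multiset.map_cons, ← Multiset.cons_coe,
    List.getElem_eraseIdx_of_lt _ hij, erase_right_comm] at h
  exact (Multiset.cons_inj_right _).mp h

variable {ns : List ℕ}

lemma Ncal_join (g : ℕ) (hpos : ∀ n ∈ ns, 0 < n) {m : ℕ} (hm : 2 * g + ns.length = m + 1)
    {i j : Fin ns.length} (hij : i < j) :
    Ncal g ((ns.get i + ns.get j + 2) :: ((ns.eraseIdx j.val).eraseIdx i.val)) =
      1 / 4 ^ g * (((ns.sum + 2 * m - 1).factorial : ℚ) / ((ns.sum + m + 1).factorial : ℚ)) *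
        coeff m (oddPart (ns.get i + ns.get j + 2) *
          ∏ k ∈ (univ.erase i).erase j, oddPart (ns.get k)) := by
  have hlen : ((ns.eraseIdx j.val).eraseIdx i.val).length + 2 = ns.length := by
    have h1 := List.length_eraseIdx_of_lt j.isLt
    have h2 := List.length_eraseIdx_of_lt (l := ns.eraseIdx j.val) (i := i.val) (by omega)
    omega
  have hsum : ((ns.eraseIdx j.val).eraseIdx i.val).sum + ns.get i + ns.get j = ns.sum := by
    have hi : i.val < (ns.eraseIdx j.val).length := by
      rw [List.length_eraseIdx_of_lt j.isLt]
      omega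
    have h1 := (List.getElem_cons_eraseIdx_perm hi).sum_eq
    rw [List.sum_cons, List.getElem_eraseIdx_of_lt _ hij] at h1
    have h2 := (List.getElem_cons_eraseIdx_perm j.isLt).sum_eq
    rw [List.sum_cons] at h2
    simp only [List.get_eq_getElem]
    omega
  have hprod : (((ns.eraseIdx j.val).eraseIdx i.val).map oddPart).prod =
      ∏ k ∈ (univ.erase i).erase j, oddPart (ns.get k) := by
    have h := congrArg (fun s => (s.map oddPart).prod) (coe_eraseIdx_eraseIdx ns hij)
    simp only [Multiset.map_coe, Multiset.prod_coe, Multiset.map_map] at h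
    exact h
  rw [Ncal_eq_coeff g (List.cons_ne_nil _ _), List.map_cons, List.prod_cons, hprod, List.sum_cons,
    List.length_cons]
  · congr 5 <;> omega
  · intro n hn
    rcases List.mem_cons.mp hn with rfl | hn
    · omega
    · exact hpos n (List.mem_of_mem_eraseIdx (List.mem_of_mem_eraseIdx hn))

lemma Ncal_cut (g : ℕ) (hpos : ∀ n ∈ ns, 0 < n) {m : ℕ} (hm : 2 * g + ns.length = m + 1)
    (i : Fin ns.length) {x : ℕ} (hx : x ∈ Icc 1 (ns.get i + 1)) :
    Ncal ((g : ℤ) - 1) ((ns.get i + 2 - x) :: x :: (ns.eraseIdx i.val)) =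
      4 * (1 / 4 ^ g * (((ns.sum + 2 * m - 1).factorial : ℚ) / ((ns.sum + m + 1).factorial : ℚ))) *
        coeff m (oddPart (ns.get i + 2 - x) * oddPart x *
          ∏ k ∈ univ.erase i, oddPart (ns.get k)) := by
  rw [mem_Icc] at hx
  have hlen : (ns.eraseIdx i.val).length + 1 = ns.length := by
    rw [List.length_eraseIdx_of_lt i.isLt]
    exact Nat.sub_add_cancel (Nat.one_le_of_lt i.isLt)
  have hsum : (ns.eraseIdx i.val).sum + ns.get i = ns.sum := by
    have h := (List.getElem_cons_eraseIdx_perm i.isLt).sum_eq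
    rw [List.sum_cons] at h
    simp only [List.get_eq_getElem]
    omega
  have hpos' : ∀ n ∈ (ns.get i + 2 - x) :: x :: (ns.eraseIdx i.val), 0 < n := by
    intro n hn
    rcases List.mem_cons.mp hn with rfl | hn
    · omega
    rcases List.mem_cons.mp hn with rfl | hn
    · omega
    · exact hpos n (List.mem_of_mem_eraseIdx hn)
  have hprod : (((ns.get i + 2 - x) :: x :: (ns.eraseIdx i.val)).map oddPart).prod =
      oddPart (ns.get i + 2 - x) * oddPart x * ∏ k ∈ univ.erase i, oddPart (ns.get k) := by
    have h := congrArg (fun s => (s.map oddPart).prod) (coe_eraseIdx ns i)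
    simp only [Multiset.map_coe, Multiset.prod_coe, Multiset.map_map] at h
    rw [List.map_cons, List.map_cons, List.prod_cons, List.prod_cons, h, mul_assoc]
    rfl
  cases g with
  | zero =>
    rw [← hprod, coeff_prod_map_oddPart_of_lt hpos' (by simp only [List.length_cons]; omega)]
    simp [Ncal]
  | succ g =>
    rw [show ((g + 1 : ℕ) : ℤ) - 1 = (g : ℤ) by push_cast; ring,
      Ncal_eq_coeff g (List.cons_ne_nil _ _) hpos', hprod]
    simp only [List.sum_cons, List.length_cons]
    rw [show ns.get i + 2 - x + (x + (ns.eraseIdx i.val).sum) + 4 * g +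
        2 * ((ns.eraseIdx i.val).length + 1 + 1) - 3 = ns.sum + 2 * m - 1 by omega,
      show ns.get i + 2 - x + (x + (ns.eraseIdx i.val).sum) + 2 * g +
        ((ns.eraseIdx i.val).length + 1 + 1) - 1 = ns.sum + m + 1 by omega,
      show 2 * g + ((ns.eraseIdx i.val).length + 1 + 1) = m by omega, pow_succ]
    field_simp

end OddGeom

/-- **Lemma I.** The explicit formula satisfies the recursion
`(L + 2g − 1) · N_{g,L}(n_1,…,n_L)
  = Σ_{i<j} n_i n_j · N_{g,L−1}(n_i+n_j+2, n_1,…,ň_i,…,ň_j,…,n_L)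
  + (1/2) Σ_i n_i Σ_{x=1}^{n_i+1} N_{g−1,L+1}(n_i+2−x, x, n_1,…,ň_i,…,n_L)`. -/
theorem Ncal_recursion (g : ℤ) (hg : 0 ≤ g) (ns : List ℕ) (hL : 1 ≤ ns.length)
    (hpos : ∀ n ∈ ns, 0 < n) :
    ((ns.length : ℚ) + 2 * (g : ℚ) - 1) * Ncal g ns =
      (∑ i : Fin ns.length, ∑ j ∈ Finset.Ioi i,
        (ns.get i : ℚ) * (ns.get j : ℚ) *
          Ncal g ((ns.get i + ns.get j + 2) :: ((ns.eraseIdx j.val).eraseIdx i.val))) +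
      (1 / 2 : ℚ) * ∑ i : Fin ns.length, (ns.get i : ℚ) *
        ∑ x ∈ Finset.Icc 1 (ns.get i + 1),
          Ncal (g - 1) ((ns.get i + 2 - x) :: x :: (ns.eraseIdx i.val)) := by
  obtain ⟨g, rfl⟩ := Int.eq_ofNat_of_zero_le hg
  obtain ⟨m, hm⟩ : ∃ m, 2 * g + ns.length = m + 1 := ⟨2 * g + ns.length - 1, by omega⟩
  have hne : ns ≠ [] := List.ne_nil_of_length_pos hL
  have hsum : ns.sum = ∑ i, ns.get i := by rw [← List.sum_ofFn, List.ofFn_get]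
  have hprod : (ns.map OddGeom.oddPart).prod = ∏ i, OddGeom.oddPart (ns.get i) := by
    rw [← List.prod_ofFn, List.ofFn_comp', List.ofFn_get]
  have hmQ : 2 * (g : ℚ) + ns.length = m + 1 := by exact_mod_cast hm
  have key := OddGeom.coeff_join_add_cut ns.get m
  rw [← hsum, ← hprod] at key
  have hfact : ((ns.sum + m + 1).factorial : ℚ) =
      ((ns.sum : ℚ) + m + 1) * (ns.sum + m).factorial := by
    rw [Nat.factorial_succ]
    push_cast
    ring
  rw [sum_congr rfl fun i _ => sum_congr rfl fun j hj => by
      rw [OddGeom.Ncal_join g hpos hm (mem_Ioi.mp hj)],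
    sum_congr rfl fun i _ => congrArg _ (sum_congr rfl fun x hx =>
      OddGeom.Ncal_cut g hpos hm i hx), OddGeom.Ncal_eq_coeff g hne hpos, hm,
    show ns.sum + 4 * g + 2 * ns.length - 3 = ns.sum + 2 * m - 1 by omega,
    show ns.sum + 2 * g + ns.length - 1 = ns.sum + m by omega]
  set c : ℚ := 1 / 4 ^ g *
    (((ns.sum + 2 * m - 1).factorial : ℚ) / ((ns.sum + m + 1).factorial : ℚ)) with hc
  have hc' : 1 / 4 ^ g * (((ns.sum + 2 * m - 1).factorial : ℚ) / ((ns.sum + m).factorial : ℚ)) =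
      c * ((ns.sum : ℚ) + m + 1) := by
    rw [hc, hfact]
    field_simp
  rw [hc', Int.cast_natCast, show (ns.length : ℚ) + 2 * g - 1 = m by linarith]
  simp only [← mul_sum, mul_left_comm _ c, mul_left_comm _ (4 * c)]
  linear_combination -c * key
end

section
/- Theorem II (recursion allowing zero arguments): the function Ñ_{g,L} defined by the explicit formula with ñ-factors satisfies, for every integer g ≥ 0, every integer L ≥ 1 and all nonnegative integers n_1, …, n_L with n_1 + ⋯ + n_L ≥ 1, the recursion (L + 2g − 1) · Ñ_{g,L}(n_1, …, n_L) = Σ_{1 ≤ i < j ≤ L} ñ_i ñ_j · Ñ_{g,L−1}(n_i + n_j + 2, n_1, …, ň_i, …, ň_j, …, n_L) + (1/2) Σ_{i=1}^{L} ñ_i · Σ_{x=1}^{n_i+1} Ñ_{g−1,L+1}(n_i + 2 − x, x, n_1, …, ň_i, …, n_L), where ň denotes omission of an argument. -/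
open Finset

/-- `ñ = n` for `n > 0` and `ñ = 1` for `n = 0`. -/
def ntilde (n : ℕ) : ℕ := if n = 0 then 1 else n

/-- The explicit formula `Ñ_{g,L}(n_1, …, n_L)` with the `ñ`-factors (genus `g : ℤ`,
boundary lengths given by the list `ns` of length `L`, entries allowed to be zero),
with the convention that the value is `0` when `g < 0` or `L = 0`. -/
noncomputable def NcalT (g : ℤ) (ns : List ℕ) : ℚ :=
  if g < 0 ∨ ns = [] then 0
  else
    (1 / 4 ^ g.toNat) * (ns.map (fun n => (ntilde n : ℚ))).prod *
      ((Nat.factorial (ns.sum + 4 * g.toNat + 2 * ns.length - 3) : ℚ) /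
        (Nat.factorial (ns.sum + 2 * g.toNat + ns.length - 1) : ℚ)) *
      ∑ lam ∈ Finset.Nat.antidiagonalTuple ns.length g.toNat,
        ∏ k : Fin ns.length,
          (Nat.factorial (2 * lam k + ns.get k) : ℚ) /
            ((Nat.factorial (ns.get k) : ℚ) * (Nat.factorial (2 * lam k + 1) : ℚ))

section

open PowerSeries

/-- The even power series `∑ ñ (2m+n)! / (n! (2m+1)!) t^m` whose products of coefficients are
summed in `NcalT`. -/
noncomputable def evenSeries (n : ℕ) : ℚ⟦X⟧ :=
  PowerSeries.mk fun m => (ntilde n : ℚ) *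
    ((Nat.factorial (2 * m + n) : ℚ) / ((Nat.factorial n : ℚ) * (Nat.factorial (2 * m + 1) : ℚ)))

/-- The odd power series `X · evenSeries n (X ^ 2)`: it is `((1 - X)⁻ⁿ - (1 + X)⁻ⁿ) / 2` for
`n > 0` and `artanh X` for `n = 0`. -/
noncomputable def oddSeries (n : ℕ) : ℚ⟦X⟧ :=
  PowerSeries.X * PowerSeries.expand 2 two_ne_zero (evenSeries n)

/-- The product of the series `oddSeries n` over the entries `n` of a list. -/
noncomputable def oddProd (l : List ℕ) : ℚ⟦X⟧ := (l.map oddSeries).prod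

/-- The geometric series `1 / (1 - X)`. -/
noncomputable def invOneSub : ℚ⟦X⟧ := PowerSeries.mk 1

/-- The alternating geometric series `1 / (1 + X)`. -/
noncomputable def invOneAdd : ℚ⟦X⟧ := PowerSeries.rescale (-1) (PowerSeries.mk 1)

instance : CharZero ℚ⟦X⟧ := algebraRat.charZero _

theorem invOneSub_eq : invOneSub = 1 + X * invOneSub := by
  have h : invOneSub * (1 - X) = 1 := mk_one_mul_one_sub_eq_one ℚ
  linear_combination h

theorem invOneAdd_eq : invOneAdd = 1 - X * invOneAdd := by
  have h : invOneAdd * (1 + X) = 1 := by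
    have h := congrArg (rescale (-1 : ℚ)) (mk_one_mul_one_sub_eq_one ℚ)
    rw [map_mul, map_sub, map_one, rescale_neg_one_X] at h
    rwa [sub_neg_eq_add] at h
  linear_combination h

theorem constantCoeff_invOneSub : constantCoeff invOneSub = 1 := by
  simp [invOneSub, ← coeff_zero_eq_constantCoeff_apply]

theorem constantCoeff_invOneAdd : constantCoeff invOneAdd = 1 := by
  simp [invOneAdd, ← coeff_zero_eq_constantCoeff_apply]

theorem derivative_invOneSub : d⁄dX ℚ invOneSub = invOneSub ^ 2 := by
  have h := congrArg (d⁄dX ℚ) invOneSub_eq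
  simp only [map_add, Derivation.leibniz, derivative_X, derivative_one, smul_eq_mul] at h
  have h' := invOneSub_eq
  linear_combination invOneSub * h - d⁄dX ℚ invOneSub * h'

theorem derivative_invOneAdd : d⁄dX ℚ invOneAdd = -invOneAdd ^ 2 := by
  have h := congrArg (d⁄dX ℚ) invOneAdd_eq
  simp only [map_sub, Derivation.leibniz, derivative_X, derivative_one, smul_eq_mul] at h
  have h' := invOneAdd_eq
  linear_combination invOneAdd * h - d⁄dX ℚ invOneAdd * h'

theorem derivative_invOneSub_pow (n : ℕ) :
    d⁄dX ℚ (invOneSub ^ n) = n * invOneSub ^ (n + 1) := by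
  cases n with
  | zero => simp
  | succ n => rw [derivative_pow, derivative_invOneSub, Nat.add_sub_cancel]; ring

theorem derivative_invOneAdd_pow (n : ℕ) :
    d⁄dX ℚ (invOneAdd ^ n) = -(n * invOneAdd ^ (n + 1)) := by
  cases n with
  | zero => simp
  | succ n => rw [derivative_pow, derivative_invOneAdd, Nat.add_sub_cancel]; ring

theorem coeff_invOneSub_pow (n m : ℕ) :
    coeff m (invOneSub ^ (n + 1)) = (Nat.choose (n + m) n : ℚ) := by
  rw [invOneSub, mk_one_pow_eq_mk_choose_add, coeff_mk]

theorem coeff_invOneAdd_pow (n m : ℕ) :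
    coeff m (invOneAdd ^ (n + 1)) = (-1) ^ m * (Nat.choose (n + m) n : ℚ) := by
  rw [invOneAdd, ← map_pow, coeff_rescale, mk_one_pow_eq_mk_choose_add, coeff_mk]

theorem two_mul_derivative_oddSeries (n : ℕ) :
    2 * d⁄dX ℚ (oddSeries n) = ntilde n * (invOneSub ^ (n + 1) + invOneAdd ^ (n + 1)) := by
  have h2 : (2 : ℚ⟦X⟧) = C (2 : ℚ) := (map_ofNat C 2).symm
  have hn : (ntilde n : ℚ⟦X⟧) = C (ntilde n : ℚ) := by simp
  ext m
  rw [h2, hn, coeff_C_mul, coeff_C_mul, map_add, coeff_invOneSub_pow, coeff_invOneAdd_pow,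
    coeff_derivative, oddSeries, coeff_succ_X_mul]
  rcases Nat.even_or_odd' m with ⟨k, rfl | rfl⟩
  · rw [coeff_expand_mul, evenSeries, coeff_mk, add_comm n, Nat.add_choose, Nat.factorial_succ,
      Nat.cast_div (Nat.factorial_mul_factorial_dvd_factorial_add _ _) (by positivity)]
    have := Nat.factorial_ne_zero (2 * k)
    have := Nat.factorial_ne_zero n
    push_cast
    rw [pow_mul]
    field_simp
    norm_num [mul_comm]
  · rw [coeff_expand_of_not_dvd _ _ _ (by omega)]
    simp [pow_succ, pow_mul]

theorem two_mul_natCast_mul_oddSeries (n : ℕ) :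
    2 * (n * oddSeries n) = ntilde n * (invOneSub ^ n - invOneAdd ^ n) := by
  apply derivative.ext
  · have h := two_mul_derivative_oddSeries n
    rw [show 2 * (n * oddSeries n) = (2 * n : ℕ) • oddSeries n by simp [mul_assoc],
      show (ntilde n : ℚ⟦X⟧) * (invOneSub ^ n - invOneAdd ^ n)
        = ntilde n • (invOneSub ^ n - invOneAdd ^ n) by simp,
      map_nsmul, map_nsmul, map_sub, derivative_invOneSub_pow, derivative_invOneAdd_pow]
    simp only [nsmul_eq_mul]
    push_cast
    linear_combination n * h
  · simp [oddSeries, constantCoeff_invOneSub, constantCoeff_invOneAdd]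

theorem two_mul_oddSeries {n : ℕ} (hn : n ≠ 0) :
    2 * oddSeries n = invOneSub ^ n - invOneAdd ^ n := by
  have h := two_mul_natCast_mul_oddSeries n
  rw [ntilde, if_neg hn] at h
  apply mul_left_cancel₀ (Nat.cast_ne_zero.mpr hn : (n : ℚ⟦X⟧) ≠ 0)
  linear_combination h

theorem two_mul_derivative_derivative_oddSeries (n : ℕ) :
    2 * d⁄dX ℚ (d⁄dX ℚ (oddSeries n)) =
      ntilde n * ((n + 1) * (invOneSub ^ (n + 2) - invOneAdd ^ (n + 2))) := by
  have h := congrArg (d⁄dX ℚ) (two_mul_derivative_oddSeries n)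
  rw [show 2 * d⁄dX ℚ (oddSeries n) = (2 : ℕ) • d⁄dX ℚ (oddSeries n) by simp,
    ← nsmul_eq_mul, map_nsmul, map_nsmul, map_add, derivative_invOneSub_pow,
    derivative_invOneAdd_pow] at h
  simp only [nsmul_eq_mul] at h
  push_cast at h
  linear_combination h

theorem two_mul_X_mul_sum_invOneSub_mul_invOneAdd (n : ℕ) :
    2 * X * ∑ i ∈ range n, invOneSub ^ (i + 1) * invOneAdd ^ (n - 1 - i + 1) =
      invOneSub ^ n - invOneAdd ^ n := by
  have h := (Commute.all invOneSub invOneAdd).geom_sum₂_mul n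
  have hs : ∑ i ∈ range n, invOneSub ^ (i + 1) * invOneAdd ^ (n - 1 - i + 1) =
      invOneSub * invOneAdd * ∑ i ∈ range n, invOneSub ^ i * invOneAdd ^ (n - 1 - i) := by
    rw [mul_sum]
    exact sum_congr rfl fun i _ => by ring
  rw [hs, ← h]
  have ha := invOneSub_eq
  have hb := invOneAdd_eq
  have hab : invOneSub - invOneAdd = 2 * X * (invOneSub * invOneAdd) := by
    linear_combination invOneSub * hb * (-1) + invOneAdd * ha
  rw [hab]
  ring

theorem oddSeries_sum (n : ℕ) :
    4 * X * ∑ x ∈ Icc 1 (n + 1), oddSeries (n + 2 - x) * oddSeries x =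
      X * (((n : ℚ⟦X⟧) + 1) * (invOneSub ^ (n + 2) + invOneAdd ^ (n + 2))) -
        (invOneSub ^ (n + 1) - invOneAdd ^ (n + 1)) := by
  have h1 := two_mul_X_mul_sum_invOneSub_mul_invOneAdd (n + 1)
  have h2 := h1
  rw [← sum_range_reflect] at h2
  have hs : 4 * ∑ x ∈ Icc 1 (n + 1), oddSeries (n + 2 - x) * oddSeries x =
      ∑ i ∈ range (n + 1), ((invOneSub ^ (n + 2) + invOneAdd ^ (n + 2)) -
        invOneSub ^ (i + 1) * invOneAdd ^ (n + 1 - 1 - i + 1) -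
        invOneSub ^ (n + 1 - 1 - i + 1) *
          invOneAdd ^ (n + 1 - 1 - (n + 1 - 1 - i) + 1)) := by
    rw [mul_sum, ← Finset.Ico_add_one_right_eq_Icc, sum_Ico_eq_sum_range]
    refine sum_congr (by simp) fun i hi => ?_
    have hi' : i ≤ n := by have := mem_range.mp hi; omega
    obtain ⟨k, rfl⟩ := Nat.exists_eq_add_of_le hi'
    have e1 := two_mul_oddSeries (n := i + k + 2 - (1 + i)) (by omega)
    have e2 := two_mul_oddSeries (n := 1 + i) (by omega)
    have hk : i + k + 2 - (1 + i) = k + 1 := by omega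
    rw [hk] at e1 ⊢
    rw [show i + k + 1 - 1 - i = k by omega, show i + k + 1 - 1 - k = i by omega]
    linear_combination 2 * oddSeries (1 + i) * e1 + (invOneSub ^ (k + 1) - invOneAdd ^ (k + 1)) * e2
  rw [mul_right_comm, hs, sum_sub_distrib, sum_sub_distrib, sum_const, card_range, nsmul_eq_mul]
  push_cast
  simp only [Nat.add_sub_cancel] at h1 h2 ⊢
  refine mul_left_cancel₀ (two_ne_zero : (2 : ℚ⟦X⟧) ≠ 0) ?_
  linear_combination -h1 - h2

/-- The one-variable instance of the differential equation. -/
theorem oddSeries_self (n : ℕ) :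
    X ^ 2 * d⁄dX ℚ (d⁄dX ℚ (oddSeries n)) +
        (n : ℚ⟦X⟧) * (X * d⁄dX ℚ (oddSeries n) - oddSeries n) =
      X * (2 * ((ntilde n : ℚ⟦X⟧) * ∑ x ∈ Icc 1 (n + 1), oddSeries (n + 2 - x) * oddSeries x)) := by
  have ha := invOneSub_eq
  have hb := invOneAdd_eq
  refine mul_left_cancel₀ (two_ne_zero : (2 : ℚ⟦X⟧) ≠ 0) ?_
  linear_combination X ^ 2 * two_mul_derivative_derivative_oddSeries n +
    n * X * two_mul_derivative_oddSeries n - two_mul_natCast_mul_oddSeries n -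
    ntilde n * oddSeries_sum n +
    ntilde n * (-(n + 1) * X * invOneSub ^ (n + 1) + invOneSub ^ n) * ha +
    ntilde n * (-(n + 1) * X * invOneAdd ^ (n + 1) - invOneAdd ^ n) * hb

/-- The two-variable instance of the differential equation. -/
theorem oddSeries_pair (n k : ℕ) :
    2 * X * (d⁄dX ℚ (oddSeries n) * d⁄dX ℚ (oddSeries k)) +
        (n : ℚ⟦X⟧) * oddSeries n * d⁄dX ℚ (oddSeries k) + (k : ℚ⟦X⟧) * oddSeries k * d⁄dX ℚ (oddSeries n) =
      (ntilde n : ℚ⟦X⟧) * (ntilde k : ℚ⟦X⟧) * oddSeries (n + k + 2) := by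
  have ha := invOneSub_eq
  have hb := invOneAdd_eq
  have hn := two_mul_natCast_mul_oddSeries n
  have hk := two_mul_natCast_mul_oddSeries k
  have hn' := two_mul_derivative_oddSeries n
  have hk' := two_mul_derivative_oddSeries k
  have hs := two_mul_oddSeries (n := n + k + 2) (by omega)
  have h : X * ((invOneSub ^ (n + 1) + invOneAdd ^ (n + 1)) *
      (invOneSub ^ (k + 1) + invOneAdd ^ (k + 1))) * 2 +
      (invOneSub ^ n - invOneAdd ^ n) * (invOneSub ^ (k + 1) + invOneAdd ^ (k + 1)) +
      (invOneSub ^ k - invOneAdd ^ k) * (invOneSub ^ (n + 1) + invOneAdd ^ (n + 1)) =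
      2 * (invOneSub ^ (n + k + 2) - invOneAdd ^ (n + k + 2)) := by
    linear_combination
      (-2 * invOneSub ^ (n + k + 1) - invOneAdd * (invOneSub ^ n * invOneAdd ^ k +
        invOneAdd ^ n * invOneSub ^ k)) * ha +
      (2 * invOneAdd ^ (n + k + 1) + invOneSub * (invOneSub ^ n * invOneAdd ^ k +
        invOneAdd ^ n * invOneSub ^ k)) * hb
  refine mul_left_cancel₀ (by norm_num : (4 : ℚ⟦X⟧) ≠ 0) ?_
  linear_combination 4 * X * d⁄dX ℚ (oddSeries k) * hn' +
    2 * X * ntilde n * (invOneSub ^ (n + 1) + invOneAdd ^ (n + 1)) * hk' +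
    2 * d⁄dX ℚ (oddSeries k) * hn + ntilde n * (invOneSub ^ n - invOneAdd ^ n) * hk' +
    2 * d⁄dX ℚ (oddSeries n) * hk + ntilde k * (invOneSub ^ k - invOneAdd ^ k) * hn' -
    2 * ntilde n * ntilde k * hs + ntilde n * ntilde k * h

theorem oddProd_cons (n : ℕ) (l : List ℕ) : oddProd (n :: l) = oddSeries n * oddProd l := by
  simp [oddProd]

theorem sum_get_eraseIdx_cons {α M : Type*} [AddCommMonoid M] (F : α → List α → M) (a : α)
    (l : List α) :
    ∑ i : Fin (a :: l).length, F ((a :: l).get i) ((a :: l).eraseIdx i.val) =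
      F a l + ∑ i : Fin l.length, F (l.get i) (a :: l.eraseIdx i.val) :=
  Fin.sum_univ_succ (n := l.length) _

theorem sum_get_get_eraseIdx_cons {α M : Type*} [AddCommMonoid M] (F : α → α → List α → M)
    (a : α) (l : List α) :
    ∑ i : Fin (a :: l).length, ∑ j ∈ Ioi i,
        F ((a :: l).get i) ((a :: l).get j) (((a :: l).eraseIdx j.val).eraseIdx i.val) =
      ∑ j : Fin l.length, F a (l.get j) (l.eraseIdx j.val) +
        ∑ i : Fin l.length, ∑ j ∈ Ioi i,
          F (l.get i) (l.get j) (a :: (l.eraseIdx j.val).eraseIdx i.val) :=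
  (Fin.sum_univ_succ (n := l.length) _).trans (congrArg₂ (· + ·)
    (Fin.sum_Ioi_zero (n := l.length) _)
    (sum_congr rfl fun i _ => Fin.sum_Ioi_succ (n := l.length) _ i))

theorem derivative_oddProd (l : List ℕ) :
    d⁄dX ℚ (oddProd l) =
      ∑ j : Fin l.length, d⁄dX ℚ (oddSeries (l.get j)) * oddProd (l.eraseIdx j.val) := by
  induction l with
  | nil => simp [oddProd]
  | cons n l ih =>
    rw [sum_get_eraseIdx_cons (fun k t => d⁄dX ℚ (oddSeries k) * oddProd t)]
    simp only [oddProd_cons, Derivation.leibniz, smul_eq_mul, ih, mul_sum]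
    rw [add_comm]
    congr 1
    · exact mul_comm _ _
    · exact sum_congr rfl fun _ _ => by ring

theorem sum_mul_oddProd (l : List ℕ) :
    (l.sum : ℚ⟦X⟧) * oddProd l =
      ∑ j : Fin l.length,
        (l.get j : ℚ⟦X⟧) * oddSeries (l.get j) * oddProd (l.eraseIdx j.val) := by
  induction l with
  | nil => simp
  | cons n l ih =>
    rw [sum_get_eraseIdx_cons (fun (k : ℕ) t => (k : ℚ⟦X⟧) * oddSeries k * oddProd t)]
    simp only [oddProd_cons, List.sum_cons, Nat.cast_add]
    rw [add_mul]
    congr 1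
    · exact (mul_assoc _ _ _).symm
    · rw [mul_left_comm, ih, mul_sum]
      exact sum_congr rfl fun _ _ => by ring

/-- The generating series of the right-hand side of the recursion. -/
noncomputable def recursionSeries (l : List ℕ) : ℚ⟦X⟧ :=
  (∑ i : Fin l.length, ∑ j ∈ Ioi i,
    (ntilde (l.get i) : ℚ⟦X⟧) * (ntilde (l.get j) : ℚ⟦X⟧) *
      oddProd ((l.get i + l.get j + 2) :: ((l.eraseIdx j.val).eraseIdx i.val))) +
  2 * ∑ i : Fin l.length, (ntilde (l.get i) : ℚ⟦X⟧) *
    ∑ x ∈ Icc 1 (l.get i + 1), oddProd ((l.get i + 2 - x) :: x :: (l.eraseIdx i.val))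

theorem recursionSeries_cons (n : ℕ) (l : List ℕ) :
    recursionSeries (n :: l) = oddSeries n * recursionSeries l +
      oddProd l *
        (2 * ((ntilde n : ℚ⟦X⟧) * ∑ x ∈ Icc 1 (n + 1), oddSeries (n + 2 - x) * oddSeries x)) +
      ∑ j : Fin l.length, (ntilde n : ℚ⟦X⟧) * (ntilde (l.get j) : ℚ⟦X⟧) *
        oddSeries (n + l.get j + 2) * oddProd (l.eraseIdx j.val) := by
  have e1 : ∑ i : Fin l.length, ∑ j ∈ Ioi i,
      (ntilde (l.get i) : ℚ⟦X⟧) * (ntilde (l.get j) : ℚ⟦X⟧) *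
        (oddSeries (l.get i + l.get j + 2) *
          (oddSeries n * oddProd ((l.eraseIdx j.val).eraseIdx i.val))) =
      oddSeries n * ∑ i : Fin l.length, ∑ j ∈ Ioi i,
        (ntilde (l.get i) : ℚ⟦X⟧) * (ntilde (l.get j) : ℚ⟦X⟧) *
          (oddSeries (l.get i + l.get j + 2) *
            oddProd ((l.eraseIdx j.val).eraseIdx i.val)) := by
    simp only [mul_sum]
    exact sum_congr rfl fun _ _ => sum_congr rfl fun _ _ => by ring
  have e2 : ∑ i : Fin l.length, (ntilde (l.get i) : ℚ⟦X⟧) *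
      ∑ x ∈ Icc 1 (l.get i + 1), oddSeries (l.get i + 2 - x) *
        (oddSeries x * (oddSeries n * oddProd (l.eraseIdx i.val))) =
      oddSeries n * ∑ i : Fin l.length, (ntilde (l.get i) : ℚ⟦X⟧) *
        ∑ x ∈ Icc 1 (l.get i + 1), oddSeries (l.get i + 2 - x) *
          (oddSeries x * oddProd (l.eraseIdx i.val)) := by
    simp only [mul_sum]
    exact sum_congr rfl fun _ _ => sum_congr rfl fun _ _ => by ring
  have e3 : ∑ x ∈ Icc 1 (n + 1), oddSeries (n + 2 - x) * (oddSeries x * oddProd l) =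
      (∑ x ∈ Icc 1 (n + 1), oddSeries (n + 2 - x) * oddSeries x) * oddProd l := by
    rw [sum_mul]
    exact sum_congr rfl fun _ _ => by ring
  have e4 : ∑ j : Fin l.length, (ntilde n : ℚ⟦X⟧) * (ntilde (l.get j) : ℚ⟦X⟧) *
        (oddSeries (n + l.get j + 2) * oddProd (l.eraseIdx j.val)) =
      ∑ j : Fin l.length, (ntilde n : ℚ⟦X⟧) * (ntilde (l.get j) : ℚ⟦X⟧) *
        oddSeries (n + l.get j + 2) * oddProd (l.eraseIdx j.val) :=
    sum_congr rfl fun _ _ => by ring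
  have h : recursionSeries (n :: l) =
      (∑ j : Fin l.length, (ntilde n : ℚ⟦X⟧) * (ntilde (l.get j) : ℚ⟦X⟧) *
        (oddSeries (n + l.get j + 2) * oddProd (l.eraseIdx j.val)) +
      ∑ i : Fin l.length, ∑ j ∈ Ioi i,
        (ntilde (l.get i) : ℚ⟦X⟧) * (ntilde (l.get j) : ℚ⟦X⟧) *
          (oddSeries (l.get i + l.get j + 2) *
            (oddSeries n * oddProd ((l.eraseIdx j.val).eraseIdx i.val)))) +
      2 * ((ntilde n : ℚ⟦X⟧) *
          ∑ x ∈ Icc 1 (n + 1), oddSeries (n + 2 - x) * (oddSeries x * oddProd l) +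
        ∑ i : Fin l.length, (ntilde (l.get i) : ℚ⟦X⟧) *
          ∑ x ∈ Icc 1 (l.get i + 1), oddSeries (l.get i + 2 - x) *
            (oddSeries x * (oddSeries n * oddProd (l.eraseIdx i.val)))) := by
    rw [recursionSeries, sum_get_get_eraseIdx_cons (fun p q t =>
        (ntilde p : ℚ⟦X⟧) * (ntilde q : ℚ⟦X⟧) * oddProd ((p + q + 2) :: t)),
      sum_get_eraseIdx_cons (fun p t =>
        (ntilde p : ℚ⟦X⟧) * ∑ x ∈ Icc 1 (p + 1), oddProd ((p + 2 - x) :: x :: t))]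
    simp only [oddProd_cons]
  rw [h, e1, e2, e3, e4, recursionSeries]
  simp only [oddProd_cons]
  ring

/-- The differential equation satisfied by `oddProd`, with the factor `X` cleared. -/
theorem oddProd_differential_equation (l : List ℕ) :
    X ^ 2 * d⁄dX ℚ (d⁄dX ℚ (oddProd l)) +
        (l.sum : ℚ⟦X⟧) * (X * d⁄dX ℚ (oddProd l) - oddProd l) =
      X * recursionSeries l := by
  induction l with
  | nil => simp [oddProd, recursionSeries]
  | cons n l ih =>
    have hp : 2 * X * d⁄dX ℚ (oddSeries n) * d⁄dX ℚ (oddProd l) +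
        (n : ℚ⟦X⟧) * oddSeries n * d⁄dX ℚ (oddProd l) +
        (l.sum : ℚ⟦X⟧) * oddProd l * d⁄dX ℚ (oddSeries n) =
        ∑ j : Fin l.length, (ntilde n : ℚ⟦X⟧) * (ntilde (l.get j) : ℚ⟦X⟧) *
          oddSeries (n + l.get j + 2) * oddProd (l.eraseIdx j.val) := by
      rw [derivative_oddProd, sum_mul_oddProd, mul_sum, mul_sum, sum_mul, ← sum_add_distrib,
        ← sum_add_distrib]
      refine sum_congr rfl fun j _ => ?_
      linear_combination oddProd (l.eraseIdx j.val) * oddSeries_pair n (l.get j)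
    rw [recursionSeries_cons, ← hp]
    simp only [oddProd_cons, Derivation.leibniz, smul_eq_mul, map_add, List.sum_cons,
      Nat.cast_add]
    linear_combination oddSeries n * ih + oddProd l * oddSeries_self n

theorem coeff_oddProd_recursion (l : List ℕ) (m : ℕ) :
    ((m : ℚ) + 1 + l.sum) * (m * coeff (m + 1) (oddProd l)) = coeff m (recursionSeries l) := by
  have h := congrArg (coeff (m + 1)) (oddProd_differential_equation l)
  rw [coeff_succ_X_mul, map_add, pow_two, mul_assoc, coeff_succ_X_mul] at h
  rw [← h, show (l.sum : ℚ⟦X⟧) = C (l.sum : ℚ) from (map_natCast C _).symm, coeff_C_mul, map_sub, coeff_succ_X_mul,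
    coeff_derivative]
  cases m with
  | zero => simp
  | succ m =>
    rw [coeff_succ_X_mul, coeff_derivative, coeff_derivative]
    push_cast
    ring

theorem oddProd_eq_X_pow_mul_expand (l : List ℕ) :
    oddProd l = X ^ l.length * expand 2 two_ne_zero (l.map evenSeries).prod := by
  induction l with
  | nil => simp [oddProd]
  | cons n l ih =>
    rw [oddProd_cons, ih, List.map_cons, List.prod_cons, map_mul, List.length_cons, oddSeries]
    ring

theorem coeff_oddProd (l : List ℕ) (g : ℕ) :
    coeff (2 * g + l.length) (oddProd l) = coeff g (l.map evenSeries).prod := by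
  rw [oddProd_eq_X_pow_mul_expand, coeff_X_pow_mul, coeff_expand_mul]

theorem coeff_oddProd_of_lt {l : List ℕ} {m : ℕ} (h : m < l.length) :
    coeff m (oddProd l) = 0 := by
  rw [oddProd_eq_X_pow_mul_expand, coeff_X_pow_mul', if_neg (by omega)]

theorem coeff_fin_prod {R : Type*} [CommSemiring R] {k : ℕ} (f : Fin k → R⟦X⟧) (n : ℕ) :
    coeff n (∏ i, f i) = ∑ t ∈ Finset.Nat.antidiagonalTuple k n, ∏ i, coeff (t i) (f i) := by
  rw [coeff_prod]
  refine sum_bij' (fun t _ => ⇑t) (fun t _ => Finsupp.equivFunOnFinite.symm t) ?_ ?_ ?_ ?_ ?_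
  · intro t ht
    simpa [Finset.Nat.mem_antidiagonalTuple] using ht
  · intro t ht
    simpa [Finset.Nat.mem_antidiagonalTuple] using ht
  · intro t _
    ext
    simp
  · intro t _
    simp
  · intro t _
    rfl

theorem coeff_evenSeries_prod (l : List ℕ) (g : ℕ) :
    coeff g (l.map evenSeries).prod =
      (l.map (fun n => (ntilde n : ℚ))).prod *
        ∑ lam ∈ Finset.Nat.antidiagonalTuple l.length g,
          ∏ k : Fin l.length,
            (Nat.factorial (2 * lam k + l.get k) : ℚ) /
              ((Nat.factorial (l.get k) : ℚ) * (Nat.factorial (2 * lam k + 1) : ℚ)) := by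
  have h1 : (l.map evenSeries).prod = ∏ k : Fin l.length, evenSeries (l.get k) :=
    (Fin.prod_univ_fun_getElem l evenSeries).symm
  have h2 : (l.map (fun n => (ntilde n : ℚ))).prod =
      ∏ k : Fin l.length, (ntilde (l.get k) : ℚ) :=
    (Fin.prod_univ_fun_getElem l fun n => (ntilde n : ℚ)).symm
  rw [h1, h2, coeff_fin_prod, mul_sum]
  refine sum_congr rfl fun lam _ => ?_
  rw [← prod_mul_distrib]
  exact prod_congr rfl fun k _ => coeff_mk _ _

theorem NcalT_natCast (g : ℕ) {l : List ℕ} (hl : l ≠ []) :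
    NcalT g l = (1 / 4 ^ g) *
      ((Nat.factorial (l.sum + 4 * g + 2 * l.length - 3) : ℚ) /
        (Nat.factorial (l.sum + 2 * g + l.length - 1) : ℚ)) *
      coeff (2 * g + l.length) (oddProd l) := by
  rw [NcalT, if_neg (by simp [hl]), coeff_oddProd, coeff_evenSeries_prod, Int.toNat_natCast]
  ring

theorem NcalT_natCast_sub_one (g : ℕ) {l : List ℕ} (hl : 2 ≤ l.length) :
    NcalT ((g : ℤ) - 1) l = 4 * (1 / 4 ^ g) *
      ((Nat.factorial (l.sum + 4 * g + 2 * l.length - 7) : ℚ) /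
        (Nat.factorial (l.sum + 2 * g + l.length - 3) : ℚ)) *
      coeff (2 * g + l.length - 2) (oddProd l) := by
  cases g with
  | zero => rw [coeff_oddProd_of_lt (by omega), mul_zero, NcalT, if_pos (by simp)]
  | succ g =>
    rw [show ((g + 1 : ℕ) : ℤ) - 1 = g by push_cast; ring,
      NcalT_natCast g (List.ne_nil_of_length_pos (by omega)), pow_succ,
      show l.sum + 4 * (g + 1) + 2 * l.length - 7 = l.sum + 4 * g + 2 * l.length - 3 by omega,
      show l.sum + 2 * (g + 1) + l.length - 3 = l.sum + 2 * g + l.length - 1 by omega,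
      show 2 * (g + 1) + l.length - 2 = 2 * g + l.length by omega]
    field_simp

theorem coeff_recursionSeries (l : List ℕ) (m : ℕ) :
    coeff m (recursionSeries l) =
      (∑ i : Fin l.length, ∑ j ∈ Ioi i,
        (ntilde (l.get i) : ℚ) * (ntilde (l.get j) : ℚ) *
          coeff m (oddProd ((l.get i + l.get j + 2) :: ((l.eraseIdx j.val).eraseIdx i.val)))) +
      2 * ∑ i : Fin l.length, (ntilde (l.get i) : ℚ) *
        ∑ x ∈ Icc 1 (l.get i + 1),
          coeff m (oddProd ((l.get i + 2 - x) :: x :: (l.eraseIdx i.val))) := by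
  have hc : ∀ (k : ℕ) (f : ℚ⟦X⟧), coeff m ((k : ℚ⟦X⟧) * f) = k * coeff m f := fun k f => by
    rw [← map_natCast C, coeff_C_mul]
  have h2 : ∀ f : ℚ⟦X⟧, coeff m (2 * f) = 2 * coeff m f := fun f => hc 2 f
  simp only [recursionSeries, map_add, map_sum, mul_assoc, hc, h2]

end

theorem List.getElem_add_sum_eraseIdx (l : List ℕ) {i : ℕ} (hi : i < l.length) :
    l[i] + (l.eraseIdx i).sum = l.sum := by
  rw [← (List.getElem_cons_eraseIdx_perm hi).sum_eq, List.sum_cons]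

theorem NcalT_join (g : ℕ) (l : List ℕ) (i j : Fin l.length) (hij : i < j) :
    NcalT g ((l.get i + l.get j + 2) :: ((l.eraseIdx j.val).eraseIdx i.val)) =
      (1 / 4 ^ g) * ((Nat.factorial (l.sum + 4 * g + 2 * l.length - 3) : ℚ) /
        (Nat.factorial (l.sum + 2 * g + l.length) : ℚ)) *
      PowerSeries.coeff (2 * g + l.length - 1)
        (oddProd ((l.get i + l.get j + 2) :: ((l.eraseIdx j.val).eraseIdx i.val))) := by
  have hij' : i.val < j.val := hij
  have h1 := List.length_eraseIdx_add_one j.isLt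
  have hi : i.val < (l.eraseIdx j.val).length := by omega
  have h2 := List.length_eraseIdx_add_one hi
  have s1 := List.getElem_add_sum_eraseIdx l j.isLt
  have s2 := List.getElem_add_sum_eraseIdx (l.eraseIdx j.val) hi
  rw [List.getElem_eraseIdx_of_lt hi hij'] at s2
  have hs : ((l.get i + l.get j + 2) :: ((l.eraseIdx j.val).eraseIdx i.val)).sum = l.sum + 2 := by
    simp only [List.sum_cons, List.get_eq_getElem]
    omega
  have hlen : ((l.get i + l.get j + 2) :: ((l.eraseIdx j.val).eraseIdx i.val)).length =
      l.length - 1 := by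
    rw [List.length_cons]
    omega
  rw [NcalT_natCast g (List.cons_ne_nil _ _), hs, hlen,
    show l.sum + 2 + 4 * g + 2 * (l.length - 1) - 3 = l.sum + 4 * g + 2 * l.length - 3 by omega,
    show l.sum + 2 + 2 * g + (l.length - 1) - 1 = l.sum + 2 * g + l.length by omega,
    show 2 * g + (l.length - 1) = 2 * g + l.length - 1 by omega]

theorem NcalT_cut (g : ℕ) (l : List ℕ) (i : Fin l.length) {x : ℕ}
    (hx : x ∈ Icc 1 (l.get i + 1)) :
    NcalT ((g : ℤ) - 1) ((l.get i + 2 - x) :: x :: (l.eraseIdx i.val)) =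
      4 * (1 / 4 ^ g) * ((Nat.factorial (l.sum + 4 * g + 2 * l.length - 3) : ℚ) /
        (Nat.factorial (l.sum + 2 * g + l.length) : ℚ)) *
      PowerSeries.coeff (2 * g + l.length - 1)
        (oddProd ((l.get i + 2 - x) :: x :: (l.eraseIdx i.val))) := by
  have hx' := (mem_Icc.mp hx).2
  have h1 := List.length_eraseIdx_add_one i.isLt
  have s1 := List.getElem_add_sum_eraseIdx l i.isLt
  have hs : ((l.get i + 2 - x) :: x :: (l.eraseIdx i.val)).sum = l.sum + 2 := by
    simp only [List.sum_cons, List.get_eq_getElem] at hx' ⊢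
    omega
  have hlen : ((l.get i + 2 - x) :: x :: (l.eraseIdx i.val)).length = l.length + 1 := by
    simp only [List.length_cons]
    omega
  rw [NcalT_natCast_sub_one g (by omega), hs, hlen,
    show l.sum + 2 + 4 * g + 2 * (l.length + 1) - 7 = l.sum + 4 * g + 2 * l.length - 3 by omega,
    show l.sum + 2 + 2 * g + (l.length + 1) - 3 = l.sum + 2 * g + l.length by omega,
    show 2 * g + (l.length + 1) - 2 = 2 * g + l.length - 1 by omega]

/-- **Lemma II / Theorem II.** The explicit formula with `ñ`-factors satisfies, for
nonnegative arguments `n_1, …, n_L` with `n_1 + ⋯ + n_L ≥ 1`, the recursion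
`(L + 2g − 1) · Ñ_{g,L}(n_1,…,n_L)
  = Σ_{i<j} ñ_i ñ_j · Ñ_{g,L−1}(n_i+n_j+2, n_1,…,ň_i,…,ň_j,…,n_L)
  + (1/2) Σ_i ñ_i Σ_{x=1}^{n_i+1} Ñ_{g−1,L+1}(n_i+2−x, x, n_1,…,ň_i,…,n_L)`. -/
theorem NcalT_recursion (g : ℤ) (hg : 0 ≤ g) (ns : List ℕ) (hL : 1 ≤ ns.length)
    (hsum : 1 ≤ ns.sum) :
    ((ns.length : ℚ) + 2 * (g : ℚ) - 1) * NcalT g ns =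
      (∑ i : Fin ns.length, ∑ j ∈ Finset.Ioi i,
        (ntilde (ns.get i) : ℚ) * (ntilde (ns.get j) : ℚ) *
          NcalT g ((ns.get i + ns.get j + 2) :: ((ns.eraseIdx j.val).eraseIdx i.val))) +
      (1 / 2 : ℚ) * ∑ i : Fin ns.length, (ntilde (ns.get i) : ℚ) *
        ∑ x ∈ Finset.Icc 1 (ns.get i + 1),
          NcalT (g - 1) ((ns.get i + 2 - x) :: x :: (ns.eraseIdx i.val)) := by
  lift g to ℕ using hg
  set c : ℚ := (1 / 4 ^ g) * ((Nat.factorial (ns.sum + 4 * g + 2 * ns.length - 3) : ℚ) /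
    (Nat.factorial (ns.sum + 2 * g + ns.length) : ℚ)) with hc
  have hR : (∑ i : Fin ns.length, ∑ j ∈ Finset.Ioi i,
        (ntilde (ns.get i) : ℚ) * (ntilde (ns.get j) : ℚ) *
          NcalT g ((ns.get i + ns.get j + 2) :: ((ns.eraseIdx j.val).eraseIdx i.val))) +
      (1 / 2 : ℚ) * ∑ i : Fin ns.length, (ntilde (ns.get i) : ℚ) *
        ∑ x ∈ Finset.Icc 1 (ns.get i + 1),
          NcalT ((g : ℤ) - 1) ((ns.get i + 2 - x) :: x :: (ns.eraseIdx i.val)) =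
      c * PowerSeries.coeff (2 * g + ns.length - 1) (recursionSeries ns) := by
    rw [coeff_recursionSeries, mul_add]
    congr 1
    · simp only [mul_sum]
      refine sum_congr rfl fun i _ => sum_congr rfl fun j hj => ?_
      rw [NcalT_join g ns i j (mem_Ioi.mp hj)]
      ring
    · simp only [mul_sum]
      refine sum_congr rfl fun i _ => sum_congr rfl fun x hx => ?_
      rw [NcalT_cut g ns i hx]
      ring
  obtain ⟨m, hm⟩ : ∃ m, 2 * g + ns.length = m + 1 := ⟨2 * g + ns.length - 1, by omega⟩
  have hmQ : 2 * (g : ℚ) + ns.length = m + 1 := by exact_mod_cast hm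
  rw [hR, hm, Nat.add_sub_cancel, ← coeff_oddProd_recursion,
    NcalT_natCast g (List.ne_nil_of_length_pos hL), hm, hc,
    show ns.sum + 2 * g + ns.length - 1 = ns.sum + m by omega,
    show ns.sum + 2 * g + ns.length = ns.sum + m + 1 by omega, Nat.factorial_succ,
    Int.cast_natCast, show (ns.length : ℚ) + 2 * (g : ℚ) - 1 = m by linear_combination hmQ]
  have h1 := Nat.factorial_ne_zero (ns.sum + m)
  push_cast [-Nat.cast_list_sum]
  field_simp
  ring
end

section
/- Integrality: for all integers g ≥ 0, L ≥ 1 and positive integers n_1, …, n_L, the rational number N_{g,L}(n_1, …, n_L) given by the explicit formula is a positive integer. -/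
open Finset

/-- The power series `∑ₗ C(2l + n, 2l + 1) Xˡ`. -/
noncomputable def oddChooseSeries (n : ℕ) : PowerSeries ℤ :=
  PowerSeries.mk fun l => ((2 * l + n).choose (2 * l + 1) : ℤ)

/-- The integral span of the series `2 ^ a * (1 - X) ^ (-e)` with `2 * e = a + w`. -/
noncomputable def weightSpan (w : ℕ) : Submodule ℤ (PowerSeries ℤ) :=
  Submodule.span ℤ {p | ∃ a e : ℕ, 2 * e = a + w ∧ p = 2 ^ a * (PowerSeries.mk 1) ^ e}

theorem mul_mem_weightSpan {v w : ℕ} {p q : PowerSeries ℤ} (hp : p ∈ weightSpan v)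
    (hq : q ∈ weightSpan w) : p * q ∈ weightSpan (v + w) := by
  have h := (Submodule.span_mul_span ℤ _ _).le (Submodule.mul_mem_mul hp hq)
  refine Submodule.span_mono ?_ h
  rintro _ ⟨_, ⟨a, e, hae, rfl⟩, _, ⟨b, f, hbf, rfl⟩, rfl⟩
  exact ⟨a + b, e + f, by omega, by simp only; ring⟩

theorem oddChooseSeries_add_two (n : ℕ) :
    oddChooseSeries (n + 2) =
      2 ^ 1 * (PowerSeries.mk 1) ^ 1 * oddChooseSeries (n + 1) -
        2 ^ 0 * (PowerSeries.mk 1) ^ 1 * oddChooseSeries n := by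
  have hZ : (PowerSeries.mk 1 : PowerSeries ℤ) * (1 - PowerSeries.X) = 1 :=
    PowerSeries.mk_one_mul_one_sub_eq_one ℤ
  have key : (1 - PowerSeries.X) * oddChooseSeries (n + 2) =
      2 * oddChooseSeries (n + 1) - oddChooseSeries n := by
    ext l
    have h2 : (2 : PowerSeries ℤ) = PowerSeries.C 2 := (map_ofNat _ 2).symm
    rw [sub_mul, one_mul, h2]
    cases l with
    | zero =>
      simp only [map_sub, PowerSeries.coeff_zero_X_mul, PowerSeries.coeff_C_mul,
        oddChooseSeries, PowerSeries.coeff_mk]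
      simp
      ring
    | succ l =>
      simp only [map_sub, PowerSeries.coeff_succ_X_mul, PowerSeries.coeff_C_mul,
        oddChooseSeries, PowerSeries.coeff_mk]
      have e1 : 2 * (l + 1) + (n + 2) = (2 * l + n + 2) + 1 + 1 := by ring
      have e2 : 2 * (l + 1) + (n + 1) = (2 * l + n + 2) + 1 := by ring
      have e3 : 2 * (l + 1) + n = 2 * l + n + 2 := by ring
      have e4 : 2 * l + (n + 2) = 2 * l + n + 2 := by ring
      have e5 : 2 * (l + 1) + 1 = 2 * l + 1 + 1 + 1 := by ring
      rw [e1, e2, e3, e4, e5]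
      simp only [Nat.choose_succ_succ', Nat.cast_add]
      ring
  linear_combination (PowerSeries.mk 1) * key - oddChooseSeries (n + 2) * hZ

theorem oddChooseSeries_mem_weightSpan (n : ℕ) : oddChooseSeries n ∈ weightSpan (n + 1) := by
  induction n using Nat.twoStepInduction with
  | zero =>
    have h : oddChooseSeries 0 = 0 := by
      ext l
      simp [oddChooseSeries]
    rw [h]
    exact zero_mem _
  | one =>
    refine Submodule.subset_span ⟨0, 1, rfl, ?_⟩
    ext l
    simp [oddChooseSeries]
  | more n h₀ h₁ =>
    rw [oddChooseSeries_add_two]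
    refine sub_mem ?_ ?_
    · have h : (2 ^ 1 * (PowerSeries.mk 1) ^ 1 : PowerSeries ℤ) ∈ weightSpan 1 :=
        Submodule.subset_span ⟨1, 1, rfl, rfl⟩
      convert mul_mem_weightSpan h h₁ using 2
      ring
    · have h : (2 ^ 0 * (PowerSeries.mk 1) ^ 1 : PowerSeries ℤ) ∈ weightSpan 2 :=
        Submodule.subset_span ⟨0, 1, rfl, rfl⟩
      convert mul_mem_weightSpan h h₀ using 2
      ring

theorem prod_oddChooseSeries_mem_weightSpan (ns : List ℕ) :
    (ns.map oddChooseSeries).prod ∈ weightSpan (ns.sum + ns.length) := by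
  induction ns with
  | nil => exact Submodule.subset_span ⟨0, 0, rfl, by simp⟩
  | cons n ns ih =>
    convert mul_mem_weightSpan (oddChooseSeries_mem_weightSpan n) ih using 2
    · rw [List.sum_cons, List.length_cons]
      ring
    · rw [List.map_cons, List.prod_cons]

theorem two_pow_mul_factorial_dvd (n : ℕ) :
    2 ^ n * n.factorial ∣ (2 * n).factorial := by
  rw [← Nat.doubleFactorial_two_mul]
  rcases n with _ | n
  · simp
  · rw [show 2 * (n + 1) = (2 * n + 1) + 1 by ring, Nat.factorial_eq_mul_doubleFactorial]
    exact Dvd.intro _ rfl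

theorem two_pow_dvd_choose_mul_ascFactorial {u j g : ℕ} (hj : j ≤ g) :
    2 ^ j ∣ u.choose j * (u + 1).ascFactorial g := by
  rcases lt_or_ge u j with hu | hu
  · simp [Nat.choose_eq_zero_of_lt hu]
  obtain ⟨d, rfl⟩ := Nat.exists_eq_add_of_le hu
  have hasc : 2 ^ j ∣ (j + 1).ascFactorial g := by
    refine Dvd.dvd.trans ?_
      (Dvd.intro _ (by rw [Nat.ascFactorial_mul_ascFactorial, Nat.add_sub_cancel' hj] :
        (j + 1).ascFactorial j * (j + 1 + j).ascFactorial (g - j) = (j + 1).ascFactorial g))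
    refine Nat.dvd_of_mul_dvd_mul_left j.factorial_pos ?_
    rw [Nat.factorial_mul_ascFactorial, ← two_mul, mul_comm]
    exact two_pow_mul_factorial_dvd j
  have h : (j + d).choose j * (j + d + 1).ascFactorial g =
      (j + d + g).choose d * (j + 1).ascFactorial g := by
    refine Nat.eq_of_mul_eq_mul_right (Nat.mul_pos j.factorial_pos d.factorial_pos) ?_
    have h1 := Nat.choose_mul_factorial_mul_factorial (Nat.le_add_right j d)
    rw [Nat.add_sub_cancel_left] at h1
    have h2 := Nat.factorial_mul_ascFactorial (j + d) g
    have h3 := Nat.factorial_mul_ascFactorial j g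
    have h4 := Nat.choose_mul_factorial_mul_factorial (show d ≤ j + d + g by omega)
    rw [show j + d + g - d = j + g by omega] at h4
    calc _ = ((j + d).choose j * j.factorial * d.factorial) * (j + d + 1).ascFactorial g := by ring
      _ = (j + d + g).choose d * d.factorial * (j.factorial * (j + 1).ascFactorial g) := by
        rw [h1, h2, h3, h4]
      _ = _ := by ring
  rw [h]
  exact hasc.mul_left _

theorem two_pow_dvd_four_pow_mul_choose_mul_ascFactorial (u b g : ℕ) :
    2 ^ g ∣ 4 ^ b * ((u + b).choose g * (u + 1).ascFactorial g) := by
  rw [Nat.add_choose_eq, Finset.sum_mul, Finset.mul_sum]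
  refine Finset.dvd_sum fun ⟨j, s⟩ hjs => ?_
  have hjs : j + s = g := by simpa using hjs
  simp only
  rcases lt_or_ge b s with hb | hb
  · simp [Nat.choose_eq_zero_of_lt hb]
  have h1 := two_pow_dvd_choose_mul_ascFactorial (u := u) (show j ≤ g by omega)
  have h2 : 2 ^ s ∣ 4 ^ b :=
    (pow_dvd_pow 2 hb).trans (pow_dvd_pow_of_dvd (by norm_num) b)
  have h := mul_dvd_mul h2 (h1.mul_right (b.choose s))
  rw [← pow_add, add_comm s j, hjs] at h
  convert h using 1
  ring

theorem two_pow_mul_ascFactorial_dvd {w v : ℕ} (h₁ : w ≤ 2 * v) (h₂ : 2 * v ≤ w + 1) (g : ℕ) :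
    2 ^ g * v.ascFactorial g ∣ w.ascFactorial (2 * g) := by
  induction g with
  | zero => simp
  | succ g ih =>
    rw [show 2 * (g + 1) = 2 * g + 1 + 1 by ring, Nat.ascFactorial_succ, Nat.ascFactorial_succ,
      Nat.ascFactorial_succ, pow_succ]
    have h : 2 * (v + g) ∣ (w + (2 * g + 1)) * (w + 2 * g) := by
      rcases (by omega : w + 2 * g = 2 * (v + g) ∨ w + (2 * g + 1) = 2 * (v + g)) with h | h
      · rw [h]
        exact Dvd.intro_left _ rfl
      · rw [h]
        exact Dvd.intro _ rfl
    convert Nat.mul_dvd_mul h ih using 1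
    · ring
    · ring

theorem four_pow_dvd_coeff_mul_ascFactorial {w g D : ℕ} (hw : 0 < w) (hD : 2 * g ≤ D)
    {p : PowerSeries ℤ} (hp : p ∈ weightSpan w) :
    (4 : ℤ) ^ g ∣ PowerSeries.coeff g p * ((w + 2 * g).ascFactorial D : ℤ) := by
  induction hp using Submodule.span_induction with
  | zero => simp
  | add p q _ _ hp hq =>
    rw [map_add, add_mul]
    exact dvd_add hp hq
  | smul c p _ hp =>
    rw [map_smul, smul_eq_mul, mul_assoc]
    exact hp.mul_left c
  | mem p hp =>
    obtain ⟨a, e, hae, rfl⟩ := hp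
    obtain ⟨d, rfl⟩ : ∃ d, e = d + 1 := ⟨e - 1, by omega⟩
    have hcoeff : PowerSeries.coeff g (2 ^ a * (PowerSeries.mk 1) ^ (d + 1) : PowerSeries ℤ) =
        ((2 ^ a * (d + g).choose g : ℕ) : ℤ) := by
      have h2 : (2 ^ a : PowerSeries ℤ) = PowerSeries.C (2 ^ a) := by simp
      rw [h2, PowerSeries.coeff_C_mul, PowerSeries.mk_one_pow_eq_mk_choose_add,
        PowerSeries.coeff_mk, Nat.choose_symm_add]
      push_cast
      ring
    rw [hcoeff]
    have hnat : 4 ^ g ∣ 2 ^ a * (d + g).choose g * (w + 2 * g).ascFactorial D := by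
      refine Dvd.dvd.trans ?_ (mul_dvd_mul_left _
        (Dvd.intro _ (by rw [Nat.ascFactorial_mul_ascFactorial, Nat.add_sub_cancel' hD] :
          (w + 2 * g).ascFactorial (2 * g) * (w + 2 * g + 2 * g).ascFactorial (D - 2 * g) =
            (w + 2 * g).ascFactorial D)))
      obtain ⟨b, v, hb, hb', hv, hv', hd⟩ : ∃ b v : ℕ, 2 * b ≤ a ∧ a ≤ 2 * b + 1 ∧
          w ≤ 2 * (v + 1) ∧ 2 * (v + 1) ≤ w + 1 ∧ d = v + b :=
        ⟨a / 2, (w + 1) / 2 - 1, by omega, by omega, by omega, by omega, by omega⟩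
      have h1 := two_pow_mul_ascFactorial_dvd
        (show w + 2 * g ≤ 2 * (v + g + 1) by omega) (by omega) g
      have h2 := two_pow_dvd_four_pow_mul_choose_mul_ascFactorial (v + g) b g
      have h3 : 4 ^ b ∣ 2 ^ a := by
        rw [show 4 = 2 ^ 2 by norm_num, ← pow_mul]
        exact pow_dvd_pow 2 hb
      have h4 : 4 ^ g ∣ 4 ^ b * (v + g + b).choose g *
          (2 ^ g * (v + g + 1).ascFactorial g) := by
        have h := Nat.mul_dvd_mul_left (2 ^ g) h2
        rw [← mul_pow, show 2 * 2 = 4 by norm_num] at h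
        convert h using 1
        ring
      rw [hd, show v + b + g = v + g + b by ring]
      exact h4.trans (mul_dvd_mul (mul_dvd_mul_right h3 _) h1)
    exact_mod_cast hnat

/-- The sum of products of binomial coefficients `C(2λₖ + nₖ, 2λₖ + 1)` over the compositions
`λ` of `g`. -/
def oddChooseSum (g : ℕ) (ns : List ℕ) : ℕ :=
  ∑ lam ∈ Finset.Nat.antidiagonalTuple ns.length g,
    ∏ k : Fin ns.length, (2 * lam k + ns.get k).choose (2 * lam k + 1)

theorem coeff_prod_oddChooseSeries (g : ℕ) (ns : List ℕ) :
    PowerSeries.coeff g (ns.map oddChooseSeries).prod = (oddChooseSum g ns : ℤ) := by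
  have h : (ns.map oddChooseSeries).prod = ∏ k : Fin ns.length, oddChooseSeries (ns.get k) := by
    rw [← List.prod_ofFn, ← Function.comp_def oddChooseSeries, ← List.map_ofFn, List.ofFn_get]
  rw [h, PowerSeries.coeff_prod, oddChooseSum]
  push_cast
  refine Finset.sum_bij' (fun l _ => ⇑l) (fun l _ => Finsupp.equivFunOnFinite.symm l)
    ?_ ?_ ?_ ?_ ?_ <;>
  simp [Finset.Nat.mem_antidiagonalTuple, oddChooseSeries]

theorem oddChooseSum_pos (g : ℕ) {ns : List ℕ} (hL : ns ≠ []) (hpos : ∀ n ∈ ns, 0 < n) :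
    0 < oddChooseSum g ns := by
  obtain ⟨n, ns, rfl⟩ := List.exists_cons_of_ne_nil hL
  refine Finset.sum_pos (fun lam _ => Finset.prod_pos fun k _ => Nat.choose_pos ?_) ?_
  · have := hpos _ (List.get_mem (n :: ns) k)
    omega
  · exact ⟨Pi.single ⟨0, by simp⟩ g, by simp [Finset.Nat.mem_antidiagonalTuple]⟩

theorem mul_factorial_div_eq_choose {n : ℕ} (hn : 0 < n) (l : ℕ) :
    (n : ℚ) * ((Nat.factorial (2 * l + n) : ℚ) /
      ((Nat.factorial n : ℚ) * (Nat.factorial (2 * l + 1) : ℚ))) =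
      ((2 * l + n).choose (2 * l + 1) : ℚ) := by
  obtain ⟨m, rfl⟩ := Nat.exists_eq_succ_of_ne_zero hn.ne'
  have h := Nat.choose_mul_factorial_mul_factorial (show 2 * l + 1 ≤ 2 * l + m.succ by omega)
  rw [show 2 * l + m.succ - (2 * l + 1) = m by omega] at h
  rw [← h, Nat.factorial_succ m]
  push_cast
  have h1 : (m.factorial : ℚ) ≠ 0 := by positivity
  have h2 : ((2 * l + 1).factorial : ℚ) ≠ 0 := by positivity
  have h3 : (m : ℚ) + 1 ≠ 0 := by positivity
  field_simp

theorem prod_mul_sum_eq_oddChooseSum (g : ℕ) {ns : List ℕ} (hpos : ∀ n ∈ ns, 0 < n) :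
    (ns.map (Nat.cast : ℕ → ℚ)).prod *
      ∑ lam ∈ Finset.Nat.antidiagonalTuple ns.length g,
        ∏ k : Fin ns.length,
          (Nat.factorial (2 * lam k + ns.get k) : ℚ) /
            ((Nat.factorial (ns.get k) : ℚ) * (Nat.factorial (2 * lam k + 1) : ℚ)) =
      (oddChooseSum g ns : ℚ) := by
  have h : (ns.map (Nat.cast : ℕ → ℚ)).prod = ∏ k : Fin ns.length, (ns.get k : ℚ) := by
    exact (Fin.prod_univ_fun_getElem ns Nat.cast).symm
  rw [h, Finset.mul_sum, oddChooseSum]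
  push_cast
  refine Finset.sum_congr rfl fun lam _ => ?_
  rw [← Finset.prod_mul_distrib]
  exact Finset.prod_congr rfl fun k _ =>
    mul_factorial_div_eq_choose (hpos _ (List.get_mem ns k)) _

theorem four_pow_mul_factorial_dvd {g : ℕ} (hg : 0 < g) :
    4 ^ g * (2 * g + 1).factorial ∣ (4 * g).factorial := by
  have h1 := two_pow_mul_factorial_dvd (2 * g)
  rw [pow_mul, show 2 * (2 * g) = 4 * g by ring, show 2 ^ 2 = 4 by norm_num] at h1
  have h2 := Nat.factorial_dvd_factorial (show 2 * g + 1 ≤ 4 * g by omega)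
  obtain ⟨x, hx⟩ := Nat.factorial_dvd_factorial (show 2 * g ≤ 4 * g by omega)
  have hpos := (2 * g).factorial_pos
  rw [hx, mul_comm] at h1
  rw [hx, Nat.factorial_succ, mul_comm] at h2
  have hcop : Nat.Coprime (4 ^ g) (2 * g + 1) := by
    refine Nat.Coprime.pow_left g ?_
    rw [show 4 = 2 ^ 2 by norm_num]
    exact Nat.Coprime.pow_left 2 (by simp)
  have h3 := hcop.mul_dvd_of_dvd_of_dvd (Nat.dvd_of_mul_dvd_mul_left hpos h1)
    (Nat.dvd_of_mul_dvd_mul_left hpos h2)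
  rw [hx, Nat.factorial_succ]
  convert Nat.mul_dvd_mul_left (2 * g).factorial h3 using 1
  ring

theorem four_pow_mul_factorial_dvd_of_pos (g : ℕ) {n : ℕ} (hn : 0 < n) :
    4 ^ g * (n + 2 * g).factorial ∣
      (n + 4 * g - 1).factorial * (2 * g + n).choose (2 * g + 1) := by
  obtain ⟨m, rfl⟩ := Nat.exists_eq_succ_of_ne_zero hn.ne'
  rcases Nat.eq_zero_or_pos g with rfl | hg
  · simp [Nat.factorial_succ, mul_comm]
  obtain ⟨c, hc⟩ := four_pow_mul_factorial_dvd hg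
  have h1 := Nat.choose_mul_factorial_mul_factorial (show m ≤ m + 4 * g by omega)
  have h2 := Nat.choose_mul_factorial_mul_factorial
    (show 2 * g + 1 ≤ 2 * g + m.succ by omega)
  rw [show m + 4 * g - m = 4 * g by omega, hc] at h1
  rw [show 2 * g + m.succ - (2 * g + 1) = m by omega] at h2
  rw [show m.succ + 4 * g - 1 = m + 4 * g by omega, ← h1, add_comm m.succ, ← h2]
  exact ⟨(m + 4 * g).choose m * c, by ring⟩

theorem four_pow_mul_factorial_dvd_factorial_mul_oddChooseSum (g : ℕ) {ns : List ℕ}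
    (hL : 1 ≤ ns.length) (hpos : ∀ n ∈ ns, 0 < n) :
    4 ^ g * (ns.sum + 2 * g + ns.length - 1).factorial ∣
      (ns.sum + 4 * g + 2 * ns.length - 3).factorial * oddChooseSum g ns := by
  rcases ns with _ | ⟨n, _ | ⟨n', ns⟩⟩
  · simp at hL
  · have h := four_pow_mul_factorial_dvd_of_pos g (hpos n (by simp))
    have hsum : oddChooseSum g [n] = (2 * g + n).choose (2 * g + 1) := by
      simp [oddChooseSum, Finset.Nat.antidiagonalTuple_one]
    rw [hsum]
    convert h using 3
    · simp
    · simp only [List.sum_singleton, List.length_singleton]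
      omega
  · generalize hms : n :: n' :: ns = ms
    have hlen : 2 ≤ ms.length := by simp [← hms]
    have hmem := prod_oddChooseSeries_mem_weightSpan ms
    have h := four_pow_dvd_coeff_mul_ascFactorial (g := g) (D := 2 * g + ms.length - 2)
      (by omega) (by omega) hmem
    rw [coeff_prod_oddChooseSeries] at h
    have h : 4 ^ g ∣ oddChooseSum g ms *
        (ms.sum + ms.length + 2 * g).ascFactorial (2 * g + ms.length - 2) := by
      exact_mod_cast h
    have hfac := Nat.factorial_mul_ascFactorial' (ms.sum + ms.length + 2 * g)
      (2 * g + ms.length - 2) (by omega)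
    rw [show ms.sum + ms.length + 2 * g + (2 * g + ms.length - 2) - 1 =
        ms.sum + 4 * g + 2 * ms.length - 3 by omega,
      show ms.sum + ms.length + 2 * g - 1 = ms.sum + 2 * g + ms.length - 1 by omega] at hfac
    rw [← hfac]
    convert Nat.mul_dvd_mul_right h (ms.sum + 2 * g + ms.length - 1).factorial using 1
    ring

/-- **Integrality:** for `g ≥ 0`, `L ≥ 1` and positive integers `n_1, …, n_L`, the rational
number `N_{g,L}(n_1, …, n_L)` is a positive integer. -/
theorem Ncal_pos_integer (g : ℤ) (hg : 0 ≤ g) (ns : List ℕ) (hL : 1 ≤ ns.length)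
    (hpos : ∀ n ∈ ns, 0 < n) :
    ∃ m : ℕ, 0 < m ∧ Ncal g ns = (m : ℚ) := by
  have hne : ns ≠ [] := List.ne_nil_of_length_pos hL
  obtain ⟨m, hm⟩ := four_pow_mul_factorial_dvd_factorial_mul_oddChooseSum g.toNat hL hpos
  have hT := oddChooseSum_pos g.toNat hne hpos
  refine ⟨m, Nat.pos_of_ne_zero ?_, ?_⟩
  · rintro rfl
    rw [mul_zero] at hm
    exact (Nat.mul_pos (Nat.factorial_pos _) hT).ne' hm
  · rw [Ncal, if_neg (by simp [hne, hg])]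
    have hcast : (ns.map (fun n => (n : ℚ))) = ns.map (Nat.cast : ℕ → ℚ) := by
      simp [List.map_eq_flatMap]
    have hprod := prod_mul_sum_eq_oddChooseSum g.toNat hpos
    have hm' := congrArg (Nat.cast (R := ℚ)) hm
    push_cast at hm'
    have hfac : ((ns.sum + 2 * g.toNat + ns.length - 1).factorial : ℚ) ≠ 0 := by positivity
    rw [mul_right_comm, mul_assoc (1 / 4 ^ g.toNat : ℚ), hcast, hprod]
    field_simp
    linear_combination hm'
end
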